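/- (Non-positivity of Liouvillian eigenvalues) If A ≠ 0 is an eigenvector of the adjoint Lindblad generator L† with eigenvalue λ, then Re(λ) ≤ 0. -/

import Mathlib

open Matrix

noncomputable def LmapAdj {n K : Type*} [Fintype n] [DecidableEq n] [Fintype K]
    (H : Matrix n n ℂ) (L : K → Matrix n n ℂ) (A : Matrix n n ℂ) : Matrix n n ℂ :=
  Complex.I • (H * A - A * H) +
    ∑ k, ((L k)ᴴ * A * L k - (1/2 : ℂ) • ((L k)ᴴ * L k * A + A * ((L k)ᴴ * L k)))

open scoped ComplexOrder

theorem aux_diss {n : Type*} [Fintype n] [DecidableEq n] (L A : Matrix n n ℂ) :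
    Lᴴ * (Aᴴ * A) * L - (1/2 : ℂ) • (Lᴴ * L * (Aᴴ * A) + (Aᴴ * A) * (Lᴴ * L)) =
    (Lᴴ * A * L - (1/2 : ℂ) • (Lᴴ * L * A + A * (Lᴴ * L)))ᴴ * A
    + Aᴴ * (Lᴴ * A * L - (1/2 : ℂ) • (Lᴴ * L * A + A * (Lᴴ * L)))
    + (A * L - L * A)ᴴ * (A * L - L * A) := by
  have h : star (1/2 : ℂ) = 1/2 := by simp
  simp only [conjTranspose_sub, conjTranspose_smul, conjTranspose_add, conjTranspose_mul,
    conjTranspose_conjTranspose, h, sub_mul, mul_sub, add_mul, mul_add, smul_mul_assoc,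
    mul_smul_comm, Matrix.mul_assoc, smul_add]
  module

theorem aux_key {n K : Type*} [Fintype n] [DecidableEq n] [Fintype K]
    (H : Matrix n n ℂ) (hH : H.IsHermitian) (L : K → Matrix n n ℂ) (A : Matrix n n ℂ) :
    LmapAdj H L (Aᴴ * A) = (LmapAdj H L A)ᴴ * A + Aᴴ * LmapAdj H L A
      + ∑ k, (A * L k - L k * A)ᴴ * (A * L k - L k * A) := by
  unfold LmapAdj
  simp only [aux_diss, Finset.sum_add_distrib, conjTranspose_add, conjTranspose_sum, add_mul,
    mul_add, Finset.sum_mul, Finset.mul_sum]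
  have : Complex.I • (H * (Aᴴ * A) - Aᴴ * A * H) =
      (Complex.I • (H * A - A * H))ᴴ * A + Aᴴ * (Complex.I • (H * A - A * H)) := by
    have h : star Complex.I = - Complex.I := by simp
    simp only [conjTranspose_sub, conjTranspose_smul, conjTranspose_mul, h, hH.eq,
      sub_mul, mul_sub, smul_mul_assoc, mul_smul_comm, Matrix.mul_assoc]
    module
  rw [this]
  abel

theorem aux_one {n K : Type*} [Fintype n] [DecidableEq n] [Fintype K]
    (H : Matrix n n ℂ) (L : K → Matrix n n ℂ) (B : Matrix n n ℂ) (c : ℂ) :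
    LmapAdj H L B = - LmapAdj H L (c • 1 - B) := by
  unfold LmapAdj
  rw [neg_add, ← Finset.sum_neg_distrib]
  congr 1
  · simp only [mul_sub, sub_mul, mul_smul_comm, smul_mul_assoc, mul_one, one_mul]
    module
  · refine Finset.sum_congr rfl fun k _ => ?_
    simp only [mul_sub, sub_mul, mul_smul_comm, smul_mul_assoc, mul_one, one_mul]
    module

theorem aux_ker {n K : Type*} [Fintype n] [DecidableEq n] [Fintype K]
    (H : Matrix n n ℂ) (L : K → Matrix n n ℂ) (M : Matrix n n ℂ) (hM : M.PosSemidef)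
    (v : n → ℂ) (hv : M *ᵥ v = 0) :
    0 ≤ star v ⬝ᵥ (LmapAdj H L M *ᵥ v) := by
  have hv2 : star v ᵥ* M = 0 := by
    have := congrArg star hv
    rwa [star_mulVec, hM.isHermitian.eq, star_zero] at this
  have h1 : ∀ X : Matrix n n ℂ, star v ⬝ᵥ ((X * M) *ᵥ v) = 0 := fun X => by
    rw [← mulVec_mulVec, hv]; simp
  have h2 : ∀ X : Matrix n n ℂ, star v ⬝ᵥ ((M * X) *ᵥ v) = 0 := fun X => by
    rw [dotProduct_mulVec, ← vecMul_vecMul, hv2]; simp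
  unfold LmapAdj
  simp only [add_mulVec, sub_mulVec, smul_mulVec, sum_mulVec, dotProduct_add, dotProduct_sub,
    dotProduct_smul, dotProduct_sum, h1, h2, smul_zero, sub_zero, zero_add, add_zero]
  exact Finset.sum_nonneg fun k _ =>
    (hM.conjTranspose_mul_mul_same (L k)).dotProduct_mulVec_nonneg v

theorem aux_top {n : Type*} [Fintype n] [DecidableEq n] [Nonempty n]
    (A : Matrix n n ℂ) (hA : A ≠ 0) :
    ∃ (c : ℝ) (v : n → ℂ), 0 < c ∧ v ≠ 0 ∧ (Aᴴ * A) *ᵥ v = (c : ℂ) • v ∧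
      ((c : ℂ) • 1 - Aᴴ * A).PosSemidef := by
  have hP : (Aᴴ * A).PosSemidef := posSemidef_conjTranspose_mul_self A
  have hB := hP.isHermitian
  obtain ⟨i, hi⟩ := Finite.exists_max hB.eigenvalues
  refine ⟨hB.eigenvalues i, hB.eigenvectorBasis i, ?_, ?_, ?_, ?_⟩
  · by_contra hc
    apply hA
    rw [← conjTranspose_mul_self_eq_zero, ← hB.eigenvalues_eq_zero_iff]
    funext j
    exact le_antisymm ((hi j).trans (not_lt.1 hc)) (hP.eigenvalues_nonneg j)
  · intro h
    apply hB.eigenvectorBasis.orthonormal.ne_zero i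
    ext j
    exact congrFun h j
  · rw [hB.mulVec_eigenvectorBasis]; rfl
  · set c := hB.eigenvalues i
    have hs := hB.spectral_theorem
    rw [Unitary.conjStarAlgAut_apply] at hs
    have hU : (hB.eigenvectorUnitary : Matrix n n ℂ) * star (hB.eigenvectorUnitary : Matrix n n ℂ) = 1 :=
      Unitary.coe_mul_star_self _
    have : (c : ℂ) • 1 - Aᴴ * A = (hB.eigenvectorUnitary : Matrix n n ℂ) *
        diagonal (fun j => (c : ℂ) - hB.eigenvalues j) *
          (hB.eigenvectorUnitary : Matrix n n ℂ)ᴴ := by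
      have hd : diagonal (fun j => (c : ℂ) - hB.eigenvalues j) =
          (c : ℂ) • (1 : Matrix n n ℂ) - diagonal (RCLike.ofReal ∘ hB.eigenvalues) := by
        rw [smul_one_eq_diagonal, diagonal_sub]; rfl
      rw [hd, mul_sub, sub_mul]
      refine congrArg₂ (· - ·) ?_ hs
      rw [mul_smul_comm, mul_one, smul_mul_assoc]
      exact (congrArg (fun X => (c : ℂ) • X) hU).symm
    rw [this]
    refine PosSemidef.mul_mul_conjTranspose_same (posSemidef_diagonal_iff.2 fun j => ?_) _
    rw [← Complex.ofReal_sub]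
    exact Complex.zero_le_real.2 (sub_nonneg.2 (hi j))

theorem liouvillian_eigenvalue_nonpositive_heisenberg
    {n K : Type*} [Fintype n] [DecidableEq n] [Nonempty n] [Fintype K]
    (H : Matrix n n ℂ) (hH : H.IsHermitian) (L : K → Matrix n n ℂ)
    (A : Matrix n n ℂ) (hA : A ≠ 0) (lam : ℂ)
    (heig : LmapAdj H L A = lam • A) :
    lam.re ≤ 0 := by
  obtain ⟨c, v, hc, hv, hAv, hM⟩ := aux_top A hA
  have hk := aux_ker H L _ hM v (by rw [sub_mulVec, hAv]; simp [smul_mulVec])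
  have hkey := aux_key H hH L A
  rw [aux_one H L _ (c : ℂ), heig] at hkey
  have hS : 0 ≤ star v ⬝ᵥ ((∑ k, (A * L k - L k * A)ᴴ * (A * L k - L k * A)) *ᵥ v) := by
    rw [sum_mulVec, dotProduct_sum]
    exact Finset.sum_nonneg fun k _ =>
      (posSemidef_conjTranspose_mul_self _).dotProduct_mulVec_nonneg v
  have hv0 : 0 < star v ⬝ᵥ v := dotProduct_star_self_pos_iff.2 hv
  have h := congrArg (fun X => star v ⬝ᵥ (X *ᵥ v)) hkey
  simp only [neg_mulVec, dotProduct_neg, add_mulVec, dotProduct_add, conjTranspose_smul,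
    smul_mul_assoc, mul_smul_comm, smul_mulVec, dotProduct_smul, hAv] at h
  generalize star v ⬝ᵥ v = a at *
  generalize star v ⬝ᵥ (LmapAdj H L _ *ᵥ v) = b at *
  generalize star v ⬝ᵥ (_ *ᵥ v) = s at *
  have hr := congrArg Complex.re h
  rw [Complex.lt_def] at hv0
  rw [Complex.le_def] at hk hS
  have ha : a.im = 0 := hv0.2.symm
  simp [ha] at hr hk hS hv0
  have hca : 0 < c * a.re := mul_pos hc hv0
  nlinarith [hk.1, hS.1]
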